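/- Let w ∈ W be an involution (w² = id) and let w′ = w̃ · s_{η_{k_1}−η_{k_2}} in W″. Then ℓ″(w′) = 2(k_2 − k_1 − 1) + 4·|w̃(A) ∩ B⁻| + 4·|w̃(A) ∩ A⁻| + 4·|w̃(A) ∩ C^±| + ℓ(w) + 1, where w̃(A) = {w̃(a) : a ∈ A}. -/

import Mathlib

/-!
The Weyl group of type `Dₙ`, realized as the group of permutations `w` of `ℤ`
supported on `{±1, …, ±n}` with `w (-i) = - w i` and an even number of sign changes.
-/

open Equiv

/-- The simple reflections of type `Dₙ`, indexed by `i ∈ {1, …, n}`: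
`sᵢ = (i, i+1)(-i, -(i+1))` for `1 ≤ i ≤ n - 1`, and
`sₙ = (n-1, -n)(-(n-1), n)`. -/
def simpleRefl (n : ℕ) (i : ℕ) : Equiv.Perm ℤ :=
  if i < n then Equiv.swap (i : ℤ) ((i : ℤ) + 1) * Equiv.swap (-(i : ℤ)) (-((i : ℤ) + 1))
  else Equiv.swap ((n : ℤ) - 1) (-(n : ℤ)) * Equiv.swap (-((n : ℤ) - 1)) (n : ℤ)

/-- A word in the letters `{1, …, n}` (indices of simple reflections). -/
def IsWord (n : ℕ) (L : List ℕ) : Prop := ∀ i ∈ L, 1 ≤ i ∧ i ≤ n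

/-- The product `s_{i₁} ⋯ s_{i_l}` of the word `L = [i₁, …, i_l]`. -/
def wordProd (n : ℕ) (L : List ℕ) : Equiv.Perm ℤ := (L.map (simpleRefl n)).prod

/-- Membership in the Weyl group `W` of type `Dₙ`: a permutation of `ℤ` commuting with
negation, fixing every integer of absolute value `> n`, and with an even number of
`i ∈ {1, …, n}` such that `w i < 0`. -/
def IsD (n : ℕ) (w : Equiv.Perm ℤ) : Prop :=
  (∀ i : ℤ, w (-i) = -(w i)) ∧ (∀ i : ℤ, (n : ℤ) < |i| → w i = i) ∧
    Even (((Finset.Icc (1 : ℤ) (n : ℤ)).filter fun i => w i < 0).card)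

/-- The length `ℓ(w)`: the minimal number of factors in an expression of `w` as a
product of simple reflections. -/
noncomputable def weylLength (n : ℕ) (w : Equiv.Perm ℤ) : ℕ :=
  sInf {l | ∃ L : List ℕ, IsWord n L ∧ L.length = l ∧ wordProd n L = w}

/-- `L` is a reduced decomposition of `w`. -/
def IsReducedWord (n : ℕ) (w : Equiv.Perm ℤ) (L : List ℕ) : Prop :=
  IsWord n L ∧ wordProd n L = w ∧ L.length = weylLength n w

/-- `w` is a basic involution: `w ∈ W`, `w² = id`, and `w i ≠ -i` for all `i ∈ {1, …, n}`. -/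
def IsBasicInvolution (n : ℕ) (w : Equiv.Perm ℤ) : Prop :=
  IsD n w ∧ w * w = 1 ∧ ∀ i : ℤ, 1 ≤ i → i ≤ (n : ℤ) → w i ≠ -i

/-- The increasing bijection `φ : {1, …, n} → {1, …, n+2} ∖ {k₁, k₂}`. -/
def phiMap (k1 k2 i : ℤ) : ℤ := if i ≤ k1 - 1 then i else if i ≤ k2 - 2 then i + 1 else i + 2

/-- `a` precedes `b` when `1 / a > 1 / b`: the order
`1, 2, 3, …, -3, -2, -1` on nonzero integers. -/
abbrev Precedes (a b : ℤ) : Prop := (0 < a ∧ b < 0) ∨ (0 < a ∧ a < b) ∨ (a < b ∧ b < 0)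

/-- The letters `±1, …, ±n`. -/
noncomputable def letters (n : ℕ) : Finset ℤ := (Finset.Icc (-(n : ℤ)) n).erase 0

/-- `w` is a signed permutation of `±1, …, ±n`. -/
def IsSigned (n : ℕ) (w : Equiv.Perm ℤ) : Prop :=
  (∀ i : ℤ, w (-i) = -(w i)) ∧ ∀ i : ℤ, (n : ℤ) < |i| → w i = i

/-- The reflection `(u, v)(-u, -v)`. -/
def signedSwap (u v : ℤ) : Equiv.Perm ℤ := Equiv.swap u v * Equiv.swap (-u) (-v)

/-- The pairs of letters `(a, b)`, `a ≠ -b`, whose order is inverted by `w`. -/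
noncomputable def inversions (n : ℕ) (w : Equiv.Perm ℤ) : Finset (ℤ × ℤ) :=
  (letters n ×ˢ letters n).filter fun p =>
    p.1 ≠ -p.2 ∧ Precedes p.1 p.2 ∧ Precedes (w p.2) (w p.1)

/-- `e_u - e_v` is a simple root, with `e_{-j} = -e_j`. -/
def IsSimplePair (n : ℕ) (u v : ℤ) : Prop :=
  1 ≤ u ∧ u < n ∧ (v = u + 1 ∨ (u = (n : ℤ) - 1 ∧ v = -(n : ℤ)))

lemma mem_letters {n : ℕ} {a : ℤ} : a ∈ letters n ↔ a ≠ 0 ∧ -(n : ℤ) ≤ a ∧ a ≤ n := by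
  simp [letters]

lemma mem_inversions {n : ℕ} {w : Equiv.Perm ℤ} {a b : ℤ} :
    (a, b) ∈ inversions n w ↔ (a ∈ letters n ∧ b ∈ letters n) ∧
      a ≠ -b ∧ Precedes a b ∧ Precedes (w b) (w a) := by
  rw [inversions, Finset.mem_filter, Finset.mem_product]

lemma signedSwap_apply {u v : ℤ} (hu : u ≠ 0) (hv : v ≠ 0) (h : u ≠ v) (h' : u ≠ -v) (a : ℤ) :
    signedSwap u v a = if a = u then v else if a = v then u else
      if a = -u then -v else if a = -v then -u else a := by
  simp only [signedSwap, Equiv.Perm.mul_apply, Equiv.swap_apply_def]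
  split_ifs <;> omega

lemma signedSwap_mul_self {u v : ℤ} (hu : u ≠ 0) (hv : v ≠ 0) (h : u ≠ v) (h' : u ≠ -v) :
    signedSwap u v * signedSwap u v = 1 := by
  ext a
  rw [Equiv.Perm.mul_apply, signedSwap_apply hu hv h h' a, signedSwap_apply hu hv h h',
    Equiv.Perm.one_apply]
  split_ifs <;> omega

namespace IsSimplePair

variable {n : ℕ} {u v : ℤ}

lemma signedSwap_apply (h : IsSimplePair n u v) (a : ℤ) :
    signedSwap u v a = if a = u then v else if a = v then u else
      if a = -u then -v else if a = -v then -u else a := by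
  obtain ⟨_, _, _⟩ := h
  apply _root_.signedSwap_apply <;> omega

lemma signedSwap_mul_self (h : IsSimplePair n u v) : signedSwap u v * signedSwap u v = 1 := by
  obtain ⟨_, _, _⟩ := h
  apply _root_.signedSwap_mul_self <;> omega

lemma isSigned (h : IsSimplePair n u v) : IsSigned n (signedSwap u v) := by
  have h' := h
  obtain ⟨_, _, _⟩ := h'
  refine ⟨fun i => ?_, fun i hi => ?_⟩
  · rw [h.signedSwap_apply, h.signedSwap_apply]
    split_ifs <;> omega
  · rw [h.signedSwap_apply]
    rw [lt_abs] at hi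
    split_ifs <;> omega

/-- A simple reflection preserves the order of all pairs but those of its own root. -/
lemma precedes_iff (h : IsSimplePair n u v) {a b : ℤ} (ha : a ≠ 0 ∧ -(n : ℤ) ≤ a ∧ a ≤ n)
    (hb : b ≠ 0 ∧ -(n : ℤ) ≤ b ∧ b ≤ n) (hne : a ≠ -b) (h1 : ¬(a = u ∧ b = v))
    (h2 : ¬(a = -v ∧ b = -u)) (h3 : ¬(a = v ∧ b = u)) (h4 : ¬(a = -u ∧ b = -v)) :
    Precedes (signedSwap u v a) (signedSwap u v b) ↔ Precedes a b := by
  rw [h.signedSwap_apply, h.signedSwap_apply]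
  obtain ⟨_, _, rfl | ⟨rfl, rfl⟩⟩ := h <;> split_ifs <;> subst_vars <;> omega

lemma exists_simpleRefl (h : IsSimplePair n u v) :
    ∃ i, 1 ≤ i ∧ i ≤ n ∧ simpleRefl n i = signedSwap u v := by
  obtain ⟨h1, h2, rfl | ⟨h3, rfl⟩⟩ := h
  · refine ⟨u.toNat, by omega, by omega, ?_⟩
    rw [simpleRefl, if_pos (by omega), Int.toNat_of_nonneg (by omega), signedSwap]
  · refine ⟨n, by omega, le_rfl, ?_⟩
    rw [simpleRefl, if_neg (lt_irrefl _), signedSwap, h3, neg_neg]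

end IsSimplePair

lemma exists_isSimplePair {n i : ℕ} (hn : 2 ≤ n) (h1 : 1 ≤ i) (h2 : i ≤ n) :
    ∃ u v, IsSimplePair n u v ∧ simpleRefl n i = signedSwap u v := by
  by_cases h : i < n
  · exact ⟨i, i + 1, ⟨by omega, by omega, Or.inl rfl⟩, by rw [simpleRefl, if_pos h, signedSwap]⟩
  · refine ⟨n - 1, -n, ⟨by omega, by omega, Or.inr ⟨rfl, rfl⟩⟩, ?_⟩
    rw [simpleRefl, if_neg h, signedSwap, neg_neg]

namespace IsSigned

variable {n : ℕ} {w : Equiv.Perm ℤ}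

lemma one : IsSigned n 1 := ⟨fun _ => rfl, fun _ _ => rfl⟩

lemma mul {w' : Equiv.Perm ℤ} (h : IsSigned n w) (h' : IsSigned n w') : IsSigned n (w * w') :=
  ⟨fun i => by simp only [Equiv.Perm.mul_apply, h'.1, h.1],
    fun i hi => by rw [Equiv.Perm.mul_apply, h'.2 i hi, h.2 i hi]⟩

lemma map_zero (h : IsSigned n w) : w 0 = 0 := by
  have := h.1 0
  rw [neg_zero] at this
  omega

lemma map_ne_zero (h : IsSigned n w) {a : ℤ} (ha : a ≠ 0) : w a ≠ 0 := fun h0 =>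
  ha (w.injective (h0.trans h.map_zero.symm))

lemma map_mem (h : IsSigned n w) {a : ℤ} (ha : a ∈ letters n) : w a ∈ letters n := by
  by_contra hc
  have h0 := h.map_ne_zero (mem_letters.1 ha).1
  have hlt : (n : ℤ) < |w a| := by
    rw [mem_letters] at hc
    rw [lt_abs]
    omega
  rw [w.injective (h.2 _ hlt)] at hc
  exact hc ha

lemma map_mem_iff (h : IsSigned n w) {a : ℤ} : w a ∈ letters n ↔ a ∈ letters n := by
  refine ⟨fun hw => ?_, h.map_mem⟩
  by_contra hc
  by_cases h0 : a = 0
  · rw [h0, h.map_zero] at hw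
    exact (mem_letters.1 hw).1 rfl
  · rw [mem_letters] at hc
    rw [h.2 a (by rw [lt_abs]; omega)] at hw
    exact hc (mem_letters.1 hw)

lemma card_inversions_mul_eq {u v : ℤ} (h : IsSimplePair n u v) :
    (inversions n (w * signedSwap u v)).card = ((letters n ×ˢ letters n).filter fun p =>
      p.1 ≠ -p.2 ∧ Precedes (signedSwap u v p.1) (signedSwap u v p.2) ∧
        Precedes (w p.2) (w p.1)).card := by
  set s := signedSwap u v with hs
  have hss (a : ℤ) : s (s a) = a := by
    rw [← Equiv.Perm.mul_apply, h.signedSwap_mul_self, Equiv.Perm.one_apply]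
  have hmem (a : ℤ) : s a ∈ letters n ↔ a ∈ letters n := h.isSigned.map_mem_iff
  have hneg {a b : ℤ} (hab : a ≠ -b) : s a ≠ -s b := by
    rw [← h.isSigned.1]
    exact s.injective.ne hab
  refine Finset.card_nbij' (fun p => (s p.1, s p.2)) (fun p => (s p.1, s p.2)) ?_ ?_ ?_ ?_
  · rintro ⟨a, b⟩ hp
    rw [Finset.mem_coe, mem_inversions, Equiv.Perm.mul_apply, Equiv.Perm.mul_apply] at hp
    rw [Finset.mem_coe, Finset.mem_filter, Finset.mem_product]
    simp only [hss, hmem]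
    exact ⟨hp.1, hneg hp.2.1, hp.2.2⟩
  · rintro ⟨a, b⟩ hp
    rw [Finset.mem_coe, Finset.mem_filter, Finset.mem_product] at hp
    rw [Finset.mem_coe, mem_inversions, Equiv.Perm.mul_apply, Equiv.Perm.mul_apply]
    simp only [hss, hmem]
    exact ⟨hp.1, hneg hp.2.1, hp.2.2⟩
  · rintro ⟨a, b⟩ _
    simp only [hss]
  · rintro ⟨a, b⟩ _
    simp only [hss]

lemma inversions_eq_insert (hw : IsSigned n w) {u v : ℤ} (h : IsSimplePair n u v)
    (hinv : Precedes (w v) (w u)) :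
    inversions n w = insert (u, v) (insert (-v, -u) ((letters n ×ˢ letters n).filter fun p =>
      p.1 ≠ -p.2 ∧ Precedes (signedSwap u v p.1) (signedSwap u v p.2) ∧
        Precedes (w p.2) (w p.1))) := by
  have hu : (u, v) ∈ inversions n w := by
    obtain ⟨_, _, _⟩ := h
    rw [mem_inversions, mem_letters, mem_letters]
    refine ⟨⟨?_, ?_⟩, ?_, ?_, hinv⟩ <;> omega
  have hv : (-v, -u) ∈ inversions n w := by
    obtain ⟨_, _, _⟩ := h
    rw [mem_inversions, mem_letters, mem_letters, hw.1, hw.1]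
    refine ⟨⟨?_, ?_⟩, ?_, ?_, ?_⟩ <;> omega
  ext ⟨a, b⟩
  rw [Finset.mem_insert, Finset.mem_insert, Finset.mem_filter, Finset.mem_product,
    Prod.mk.injEq, Prod.mk.injEq]
  by_cases h1 : a = u ∧ b = v
  · obtain ⟨rfl, rfl⟩ := h1
    exact iff_of_true hu (Or.inl ⟨rfl, rfl⟩)
  by_cases h2 : a = -v ∧ b = -u
  · obtain ⟨rfl, rfl⟩ := h2
    exact iff_of_true hv (Or.inr (Or.inl ⟨rfl, rfl⟩))
  rw [or_iff_right h1, or_iff_right h2, mem_inversions]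
  refine and_congr_right fun hab => and_congr_right fun hne => and_congr_left fun hlt => ?_
  refine (h.precedes_iff (mem_letters.1 hab.1) (mem_letters.1 hab.2) hne h1 h2 ?_ ?_).symm
  · rintro ⟨rfl, rfl⟩
    clear h1 h2 hu hv hne hab
    omega
  · rintro ⟨rfl, rfl⟩
    rw [hw.1, hw.1] at hlt
    clear h1 h2 hu hv hne hab
    omega

/-- Multiplying by a simple reflection whose root is inverted removes the root and its dual
pair from the inversions. -/
lemma card_inversions_mul (hw : IsSigned n w) {u v : ℤ} (h : IsSimplePair n u v)
    (hinv : Precedes (w v) (w u)) :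
    (inversions n (w * signedSwap u v)).card + 2 = (inversions n w).card := by
  have hpair : (u, v) ≠ (-v, -u) := by
    obtain ⟨_, _, _⟩ := h
    rw [ne_eq, Prod.mk.injEq]
    omega
  rw [hw.inversions_eq_insert h hinv, Finset.card_insert_of_notMem, Finset.card_insert_of_notMem,
    card_inversions_mul_eq h]
  · rw [Finset.mem_filter]
    rintro ⟨_, _, h2, _⟩
    rw [h.signedSwap_apply, h.signedSwap_apply] at h2
    obtain ⟨_, _, _⟩ := h
    split_ifs at h2 <;> omega
  · rw [Finset.mem_insert, Finset.mem_filter, or_iff_right hpair]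
    rintro ⟨_, _, h2, _⟩
    rw [h.signedSwap_apply, h.signedSwap_apply] at h2
    obtain ⟨_, _, _⟩ := h
    split_ifs at h2 <;> omega

lemma precedes_or_precedes (hw : IsSigned n w) {a b : ℤ} (ha : a ≠ 0) (hb : b ≠ 0) (hab : a ≠ b) :
    Precedes (w a) (w b) ∨ Precedes (w b) (w a) := by
  have h1 := hw.map_ne_zero ha
  have h2 := hw.map_ne_zero hb
  have h3 := w.injective.ne hab
  omega

lemma card_inversions_mul_le (hw : IsSigned n w) {u v : ℤ} (h : IsSimplePair n u v) :
    (inversions n (w * signedSwap u v)).card ≤ (inversions n w).card + 2 := by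
  have h' := h
  obtain ⟨_, _, _⟩ := h'
  rcases hw.precedes_or_precedes (a := u) (b := v) (by omega) (by omega) (by omega) with h1 | h1
  · have := card_inversions_mul (hw.mul h.isSigned) h (by
      rw [Equiv.Perm.mul_apply, Equiv.Perm.mul_apply, h.signedSwap_apply, h.signedSwap_apply,
        if_pos rfl, if_neg (by omega), if_pos rfl]
      exact h1)
    rw [mul_assoc, h.signedSwap_mul_self, mul_one] at this
    omega
  · have := card_inversions_mul hw h h1
    omega

end IsSigned

lemma isSigned_wordProd_and_card_le {n : ℕ} (hn : 2 ≤ n) (L : List ℕ) (hL : IsWord n L) :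
    IsSigned n (wordProd n L) ∧ (inversions n (wordProd n L)).card ≤ 2 * L.length := by
  induction L using List.reverseRecOn with
  | nil =>
    refine ⟨IsSigned.one, ?_⟩
    rw [List.length_nil, mul_zero, Nat.le_zero, Finset.card_eq_zero, inversions,
      Finset.filter_eq_empty_iff]
    simp only [wordProd, List.map_nil, List.prod_nil, Equiv.Perm.one_apply]
    omega
  | append_singleton L i ih =>
    obtain ⟨h1, h2⟩ := ih fun j hj => hL j (List.mem_append_left _ hj)
    obtain ⟨hi1, hi2⟩ := hL i (by simp)
    obtain ⟨u, v, huv, hs⟩ := exists_isSimplePair hn hi1 hi2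
    have hprod : wordProd n (L ++ [i]) = wordProd n L * signedSwap u v := by
      simp [wordProd, hs]
    have := h1.card_inversions_mul_le huv
    rw [hprod, List.length_append, List.length_singleton]
    exact ⟨h1.mul huv.isSigned, by omega⟩

namespace IsD

variable {n : ℕ} {w : Equiv.Perm ℤ}

lemma isSigned (h : IsD n w) : IsSigned n w := ⟨h.1, h.2.1⟩

lemma mul_signedSwap (h : IsD n w) {u v : ℤ} (huv : IsSimplePair n u v) :
    IsD n (w * signedSwap u v) := by
  obtain ⟨h1, h2⟩ := h.isSigned.mul huv.isSigned
  refine ⟨h1, h2, ?_⟩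
  have key (f : Equiv.Perm ℤ) : ((Finset.Icc (1 : ℤ) n).filter fun i => f i < 0).card =
      (∑ i ∈ Finset.Icc (1 : ℤ) n \ {u, |v|}, if f i < 0 then 1 else 0) +
        ((if f u < 0 then 1 else 0) + if f |v| < 0 then 1 else 0) := by
    obtain ⟨h1, h2, h3⟩ := huv
    have hv : |v| = u + 1 := by
      rcases h3 with rfl | ⟨h4, rfl⟩
      · rw [abs_of_pos (by omega)]
      · rw [abs_neg, abs_of_pos (by omega)]
        omega
    rw [Finset.card_filter, ← Finset.sum_sdiff (s₁ := {u, |v|}), Finset.sum_pair (by omega)]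
    intro x hx
    simp only [Finset.mem_insert, Finset.mem_singleton, Finset.mem_Icc] at hx ⊢
    omega
  have heven := h.2.2
  rw [key] at heven ⊢
  have hrest : (∑ i ∈ Finset.Icc (1 : ℤ) n \ {u, |v|},
        if (w * signedSwap u v) i < 0 then 1 else 0) =
      ∑ i ∈ Finset.Icc (1 : ℤ) n \ {u, |v|}, if w i < 0 then 1 else 0 := by
    refine Finset.sum_congr rfl fun i hi => ?_
    simp only [Finset.mem_sdiff, Finset.mem_Icc, Finset.mem_insert, Finset.mem_singleton] at hi
    obtain ⟨_, _, h3⟩ := huv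
    have hfix : signedSwap u v i = i := by
      rw [IsSimplePair.signedSwap_apply ⟨‹_›, ‹_›, h3⟩]
      rcases abs_cases v with ⟨hv, _⟩ | ⟨hv, _⟩ <;> rw [hv] at hi <;> split_ifs <;> omega
    rw [Equiv.Perm.mul_apply, hfix]
  rw [hrest]
  have hu : (w * signedSwap u v) u = w v := by
    rw [Equiv.Perm.mul_apply, huv.signedSwap_apply, if_pos rfl]
  have hv : signedSwap u v v = u := by
    rw [huv.signedSwap_apply]
    split_ifs <;> omega
  have hw0 := h.isSigned.map_ne_zero (a := u) (by have := huv.1; omega)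
  rw [hu]
  rw [Nat.even_iff] at heven ⊢
  rcases abs_cases v with ⟨hv', _⟩ | ⟨hv', hneg⟩
  · rw [hv'] at heven ⊢
    rw [Equiv.Perm.mul_apply, hv]
    omega
  · have hw0' := h.isSigned.map_ne_zero (a := v) hneg.ne
    rw [hv'] at heven ⊢
    rw [Equiv.Perm.mul_apply, huv.isSigned.1, hv, h.1]
    rw [h.1] at heven
    split_ifs at heven ⊢ <;> omega

/-- An element of `W` inverting no simple root is the identity. -/
lemma eq_one (hn : 2 ≤ n) (h : IsD n w)
    (hs : ∀ u v, IsSimplePair n u v → ¬ Precedes (w v) (w u)) : w = 1 := by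
  have hS := h.isSigned
  have hstep (u v : ℤ) (huv : IsSimplePair n u v) : Precedes (w u) (w v) := by
    have := hs u v huv
    obtain ⟨_, _, _⟩ := huv
    rcases hS.precedes_or_precedes (a := u) (b := v) (by omega) (by omega) (by omega) with h1 | h1
    · exact h1
    · contradiction
  have hlast1 := hstep (n - 1) n ⟨by omega, by omega, Or.inl (by omega)⟩
  have hlast2 := hstep (n - 1) (-n) ⟨by omega, by omega, Or.inr ⟨rfl, rfl⟩⟩
  rw [h.1] at hlast2
  have hpos' (k : ℕ) : ∀ i : ℤ, 1 ≤ i → i = n - 1 - k → 0 < w i := by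
    induction k with
    | zero =>
      rintro i _ rfl
      simp only [Nat.cast_zero, sub_zero]
      omega
    | succ k ih =>
      intro i hi hik
      have h1 := ih (i + 1) (by omega) (by push_cast at hik; omega)
      have h2 := hstep i (i + 1) ⟨hi, by omega, Or.inl rfl⟩
      omega
  have hpos (i : ℤ) (h1 : 1 ≤ i) (h2 : i < n) : 0 < w i :=
    hpos' (n - 1 - i).toNat i h1 (by omega)
  have hposn : 0 < w n := by
    by_contra hc
    have hneg : w n < 0 := by
      have := hS.map_ne_zero (a := n) (by omega)
      omega
    have hfil : (Finset.Icc (1 : ℤ) n).filter (fun i => w i < 0) = {(n : ℤ)} := by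
      ext i
      simp only [Finset.mem_filter, Finset.mem_Icc, Finset.mem_singleton]
      constructor
      · rintro ⟨⟨h1, h2⟩, h3⟩
        by_contra h4
        have := hpos i h1 (by omega)
        omega
      · rintro rfl
        exact ⟨⟨by omega, le_rfl⟩, hneg⟩
    have := h.2.2
    rw [hfil, Finset.card_singleton] at this
    exact absurd this (by decide)
  have hmono (i : ℤ) (h1 : 1 ≤ i) (h2 : i < n) : w i < w (i + 1) := by
    have := hstep i (i + 1) ⟨h1, h2, Or.inl rfl⟩
    have := hpos i h1 h2
    have : 0 < w (i + 1) := by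
      by_cases h3 : i + 1 < n
      · exact hpos _ (by omega) h3
      · rwa [show i + 1 = n by omega]
    omega
  have hge (k : ℕ) : ∀ i : ℤ, i = k + 1 → i ≤ n → i ≤ w i := by
    induction k with
    | zero =>
      rintro i hi _
      have := hpos i (by omega) (by omega)
      push_cast at hi
      omega
    | succ k ih =>
      intro i hi hin
      have h1 := ih (i - 1) (by push_cast at hi; omega) (by omega)
      have h2 := hmono (i - 1) (by omega) (by omega)
      rw [sub_add_cancel] at h2
      omega
  have hle (k : ℕ) : ∀ i : ℤ, i = n - k → 1 ≤ i → w i ≤ i := by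
    induction k with
    | zero =>
      rintro i hi _
      have := (mem_letters.1 (hS.map_mem (a := i) (mem_letters.2 (by omega)))).2.2
      push_cast at hi
      omega
    | succ k ih =>
      intro i hi hin
      have h1 := ih (i + 1) (by push_cast at hi; omega) (by omega)
      have h2 := hmono i (by omega) (by omega)
      omega
  have heq (i : ℤ) (h1 : 1 ≤ i) (h2 : i ≤ n) : w i = i :=
    le_antisymm (hle (n - i).toNat i (by omega) h1) (hge (i - 1).toNat i (by omega) h2)
  ext i
  rw [Equiv.Perm.one_apply]
  rcases lt_trichotomy i 0 with h0 | rfl | h0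
  · by_cases hi : -i ≤ n
    · have := heq (-i) (by omega) hi
      rw [h.1] at this
      omega
    · exact h.2.1 i (by rw [lt_abs]; omega)
  · exact hS.map_zero
  · by_cases hi : i ≤ n
    · exact heq i (by omega) hi
    · exact h.2.1 i (by rw [lt_abs]; omega)

lemma exists_word (hn : 2 ≤ n) (h : IsD n w) :
    ∃ L, IsWord n L ∧ wordProd n L = w ∧ 2 * L.length ≤ (inversions n w).card := by
  induction hm : (inversions n w).card using Nat.strong_induction_on generalizing w with
  | _ m ih =>
    by_cases hs : ∃ u v, IsSimplePair n u v ∧ Precedes (w v) (w u)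
    · obtain ⟨u, v, huv, hlt⟩ := hs
      have hcard := h.isSigned.card_inversions_mul huv hlt
      obtain ⟨L, hL, hprod, hlen⟩ := ih _ (by omega) (h.mul_signedSwap huv) rfl
      obtain ⟨i, hi1, hi2, hi⟩ := huv.exists_simpleRefl
      refine ⟨L ++ [i], ?_, ?_, ?_⟩
      · intro j hj
        rcases List.mem_append.1 hj with hj | hj
        · exact hL j hj
        · rw [List.mem_singleton.1 hj]
          exact ⟨hi1, hi2⟩
      · have : wordProd n (L ++ [i]) = wordProd n L * signedSwap u v := by simp [wordProd, hi]
        rw [this, hprod, mul_assoc, huv.signedSwap_mul_self, mul_one]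
      · rw [List.length_append, List.length_singleton]
        omega
    · rw [h.eq_one hn fun u v huv hlt => hs ⟨u, v, huv, hlt⟩]
      exact ⟨[], fun _ hj => absurd hj List.not_mem_nil, rfl, by simp⟩

/-- Twice the length is the number of inversions, every root being counted as two pairs. -/
theorem two_mul_weylLength (hn : 2 ≤ n) (h : IsD n w) :
    2 * weylLength n w = (inversions n w).card := by
  obtain ⟨L, hL, hprod, hlen⟩ := h.exists_word hn
  have hle : weylLength n w ≤ L.length := Nat.sInf_le ⟨L, hL, rfl, hprod⟩
  obtain ⟨L', hL', hlen', hprod'⟩ := Nat.sInf_mem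
    (s := {l | ∃ L : List ℕ, IsWord n L ∧ L.length = l ∧ wordProd n L = w}) ⟨_, L, hL, rfl, hprod⟩
  have hge := (isSigned_wordProd_and_card_le hn L' hL').2
  rw [hprod', hlen'] at hge
  change _ ≤ 2 * weylLength n w at hge
  omega

end IsD

/-- The odd extension of `phiMap` to negative letters. -/
def signedPhi (k1 k2 i : ℤ) : ℤ := if 0 < i then phiMap k1 k2 i else -phiMap k1 k2 (-i)

section SignedPhi

variable {n : ℕ} {k1 k2 : ℤ}

lemma signedPhi_eq (k1 k2 i : ℤ) : signedPhi k1 k2 i =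
    if 0 < i then (if i ≤ k1 - 1 then i else if i ≤ k2 - 2 then i + 1 else i + 2)
    else if -i ≤ k1 - 1 then i else if -i ≤ k2 - 2 then i - 1 else i - 2 := by
  simp only [signedPhi, phiMap]
  split_ifs <;> omega

lemma signedPhi_neg {i : ℤ} (hi : i ≠ 0) : signedPhi k1 k2 (-i) = -signedPhi k1 k2 i := by
  rw [signedPhi, signedPhi, neg_neg]
  split_ifs <;> omega

lemma precedes_signedPhi {a b : ℤ} (ha : a ≠ 0) (hb : b ≠ 0) :
    Precedes (signedPhi k1 k2 a) (signedPhi k1 k2 b) ↔ Precedes a b := by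
  rw [signedPhi_eq, signedPhi_eq]
  rcases lt_or_gt_of_ne ha with ha | ha <;> rcases lt_or_gt_of_ne hb with hb | hb <;>
    simp only [ha, hb, ha.not_gt, hb.not_gt, if_true, if_false] <;> split_ifs <;> omega

lemma signedPhi_injective (k1 k2 : ℤ) : Function.Injective (signedPhi k1 k2) := by
  intro a b hab
  rw [signedPhi_eq, signedPhi_eq] at hab
  split_ifs at hab <;> omega

lemma letters_add_two (h1 : 1 ≤ k1) (h2 : k1 < k2) (h3 : k2 ≤ (n : ℤ) + 2) :
    letters (n + 2) = (letters n).image (signedPhi k1 k2) ∪ {k1, k2, -k1, -k2} := by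
  ext x
  simp only [Finset.mem_union, Finset.mem_image, Finset.mem_insert, Finset.mem_singleton,
    mem_letters]
  push_cast
  constructor
  · intro hx
    by_contra! hc
    refine hc.1 (if |x| < k1 then x else if |x| < k2 then x - x.sign else x - 2 * x.sign) ?_ ?_
    · rcases lt_or_gt_of_ne hx.1 with h0 | h0
      · rw [abs_of_neg h0, Int.sign_eq_neg_one_of_neg h0]
        split_ifs <;> omega
      · rw [abs_of_pos h0, Int.sign_eq_one_of_pos h0]
        split_ifs <;> omega
    · rw [signedPhi_eq]
      rcases lt_or_gt_of_ne hx.1 with h0 | h0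
      · rw [abs_of_neg h0, Int.sign_eq_neg_one_of_neg h0]
        split_ifs <;> omega
      · rw [abs_of_pos h0, Int.sign_eq_one_of_pos h0]
        split_ifs <;> omega
  · rintro (⟨a, ha, rfl⟩ | hx)
    · rw [signedPhi_eq]
      split_ifs <;> omega
    · omega

lemma mem_image_signedPhi (h1 : 1 ≤ k1) (h2 : k1 < k2) (h3 : k2 ≤ (n : ℤ) + 2) {x : ℤ} :
    x ∈ (letters n).image (signedPhi k1 k2) ↔ (x ≠ 0 ∧ -((n : ℤ) + 2) ≤ x ∧ x ≤ (n : ℤ) + 2) ∧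
      x ≠ k1 ∧ x ≠ k2 ∧ x ≠ -k1 ∧ x ≠ -k2 := by
  constructor
  · intro hx
    have h := Finset.mem_union_left {k1, k2, -k1, -k2} hx
    rw [← letters_add_two h1 h2 h3, mem_letters] at h
    push_cast at h
    obtain ⟨a, ha, rfl⟩ := Finset.mem_image.1 hx
    refine ⟨h, ?_⟩
    rw [signedPhi_eq]
    have := (mem_letters.1 ha).1
    split_ifs <;> omega
  · rintro ⟨h, h'⟩
    have hx : x ∈ letters (n + 2) := by
      rw [mem_letters]
      push_cast
      exact h
    rw [letters_add_two h1 h2 h3, Finset.mem_union] at hx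
    refine hx.resolve_right ?_
    simp only [Finset.mem_insert, Finset.mem_singleton]
    omega

/-- The hypothesis relating `w̃` and `w`, extended to all letters. -/
lemma apply_signedPhi {w wt : Equiv.Perm ℤ} (hw : IsSigned n w) (hwt : IsSigned (n + 2) wt)
    (hcomp : ∀ i : ℤ, 1 ≤ i → i ≤ (n : ℤ) →
      wt (phiMap k1 k2 i) = Int.sign (w i) * phiMap k1 k2 |w i|)
    {i : ℤ} (hi : i ∈ letters n) : wt (signedPhi k1 k2 i) = signedPhi k1 k2 (w i) := by
  have hpos {j : ℤ} (hj : 1 ≤ j) (hj' : j ≤ n) :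
      wt (signedPhi k1 k2 j) = signedPhi k1 k2 (w j) := by
    rw [signedPhi, if_pos (by omega), hcomp j hj hj', signedPhi]
    rcases lt_or_gt_of_ne (hw.map_ne_zero (a := j) (by omega)) with h0 | h0
    · rw [abs_of_neg h0, Int.sign_eq_neg_one_of_neg h0, if_neg h0.not_gt, neg_one_mul]
    · rw [abs_of_pos h0, Int.sign_eq_one_of_pos h0, if_pos h0, one_mul]
  rw [mem_letters] at hi
  rcases lt_or_gt_of_ne hi.1 with h0 | h0
  · have := hpos (j := -i) (by omega) (by omega)
    rwa [signedPhi_neg hi.1, hwt.1, hw.1, signedPhi_neg (hw.map_ne_zero hi.1), neg_inj] at this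
  · exact hpos (by omega) hi.2.2

end SignedPhi

/-- The indicator of an inverted pair of letters. -/
def inversionIndicator (f : Equiv.Perm ℤ) (a b : ℤ) : ℕ :=
  if a ≠ -b ∧ Precedes a b ∧ Precedes (f b) (f a) then 1 else 0

lemma card_inversions (n : ℕ) (w : Equiv.Perm ℤ) :
    (inversions n w).card = ∑ a ∈ letters n, ∑ b ∈ letters n, inversionIndicator w a b := by
  rw [inversions, Finset.card_filter, Finset.sum_product]
  rfl

lemma sum_union_sum_union {S T : Finset ℤ} (h : Disjoint S T) (f : ℤ → ℤ → ℕ) :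
    ∑ a ∈ S ∪ T, ∑ b ∈ S ∪ T, f a b = ∑ a ∈ S, ∑ b ∈ S, f a b +
      ∑ a ∈ S, ∑ b ∈ T, (f a b + f b a) + ∑ a ∈ T, ∑ b ∈ T, f a b := by
  simp only [Finset.sum_union h, Finset.sum_add_distrib]
  rw [Finset.sum_comm (s := T) (t := S)]
  ring

/-- Half the number of inversions gained by pairing `x ↦ y` with `±k1 ↦ ±k2`, `±k2 ↦ ±k1`. -/
def mixedInversions (k1 k2 x y : ℤ) : ℕ :=
  (if k1 < x ∧ x < k2 then 1 else 0) + (if k1 < y ∧ y < k2 then 1 else 0) +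
    2 * (if (0 < x ∧ x < k1) ∧ (y < 0 ∨ k2 < y) then 1 else 0) +
    2 * (if (0 < y ∧ y < k1) ∧ (x < 0 ∨ k2 < x) then 1 else 0)

lemma mixedInversions_eq {k1 k2 x y : ℤ} (h1 : 1 ≤ k1) (h2 : k1 < k2)
    (hx : x ≠ 0 ∧ x ≠ k1 ∧ x ≠ k2) (hy : y ≠ 0 ∧ y ≠ k1 ∧ y ≠ k2) :
    ((if Precedes x k1 ∧ Precedes k2 y then 1 else 0) +
        (if Precedes k1 x ∧ Precedes y k2 then 1 else 0)) +
      ((if Precedes x k2 ∧ Precedes k1 y then 1 else 0) +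
        (if Precedes k2 x ∧ Precedes y k1 then 1 else 0)) = mixedInversions k1 k2 x y := by
  rw [mixedInversions]
  have hx' : x < 0 ∨ (0 < x ∧ x < k1) ∨ (k1 < x ∧ x < k2) ∨ k2 < x := by omega
  have hy' : y < 0 ∨ (0 < y ∧ y < k1) ∨ (k1 < y ∧ y < k2) ∨ k2 < y := by omega
  clear hx hy
  rcases hx' with hx | hx | hx | hx <;> rcases hy' with hy | hy | hy | hy <;>
    simp (disch := omega) only [if_pos, if_neg]

lemma sum_inversionIndicator {k1 k2 x : ℤ} (h1 : 1 ≤ k1) (h2 : k1 < k2) {f : Equiv.Perm ℤ}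
    (hx : x ≠ 0 ∧ x ≠ k1 ∧ x ≠ k2 ∧ x ≠ -k1 ∧ x ≠ -k2)
    (hy : f x ≠ 0 ∧ f x ≠ k1 ∧ f x ≠ k2 ∧ f x ≠ -k1 ∧ f x ≠ -k2)
    (hf1 : f k1 = k2) (hf2 : f k2 = k1) (hf3 : f (-k1) = -k2) (hf4 : f (-k2) = -k1) :
    ∑ k ∈ {k1, k2, -k1, -k2}, (inversionIndicator f x k + inversionIndicator f k x) =
      mixedInversions k1 k2 x (f x) + mixedInversions k1 k2 (-x) (-f x) := by
  have hneg (k l : ℤ) : ((if Precedes (-x) k ∧ Precedes l (-f x) then 1 else 0) +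
      (if Precedes k (-x) ∧ Precedes (-f x) l then 1 else 0) : ℕ) =
      (if Precedes x (-k) ∧ Precedes (-l) (f x) then 1 else 0) +
      (if Precedes (-k) x ∧ Precedes (f x) (-l) then 1 else 0) := by
    rw [add_comm]
    exact congrArg₂ _ (if_congr (and_congr (by omega) (by omega)) rfl rfl)
      (if_congr (and_congr (by omega) (by omega)) rfl rfl)
  rw [← mixedInversions_eq h1 h2 (by omega) (by omega),
    ← mixedInversions_eq h1 h2 (by omega) (by omega), hneg, hneg]
  rw [Finset.sum_insert (by simp only [Finset.mem_insert, Finset.mem_singleton]; omega),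
    Finset.sum_insert (by simp only [Finset.mem_insert, Finset.mem_singleton]; omega),
    Finset.sum_insert (by simp only [Finset.mem_singleton]; omega), Finset.sum_singleton]
  have e1 : x ≠ -k1 ∧ x ≠ -k2 ∧ x ≠ - -k1 ∧ x ≠ - -k2 := by omega
  have e2 : k1 ≠ -x ∧ k2 ≠ -x ∧ -k1 ≠ -x ∧ -k2 ≠ -x := by omega
  simp only [inversionIndicator, hf1, hf2, hf3, hf4, e1.1, e1.2.1, e1.2.2.1, e1.2.2.2, e2.1,
    e2.2.1, e2.2.2.1, e2.2.2.2, ne_eq, not_false_eq_true, true_and]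
  ring

lemma sum_sum_inversionIndicator {k1 k2 : ℤ} (h1 : 1 ≤ k1) (h2 : k1 < k2) {f : Equiv.Perm ℤ}
    (hf1 : f k1 = k2) (hf2 : f k2 = k1) (hf3 : f (-k1) = -k2) (hf4 : f (-k2) = -k1) :
    ∑ k ∈ {k1, k2, -k1, -k2}, ∑ l ∈ {k1, k2, -k1, -k2}, inversionIndicator f k l = 2 := by
  have hsum (g : ℤ → ℕ) : ∑ k ∈ {k1, k2, -k1, -k2}, g k =
      g k1 + (g k2 + (g (-k1) + g (-k2))) := by
    rw [Finset.sum_insert (by simp only [Finset.mem_insert, Finset.mem_singleton]; omega),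
      Finset.sum_insert (by simp only [Finset.mem_insert, Finset.mem_singleton]; omega),
      Finset.sum_insert (by simp only [Finset.mem_singleton]; omega), Finset.sum_singleton]
  simp only [hsum, inversionIndicator, hf1, hf2, hf3, hf4]
  simp (disch := omega) only [if_pos, if_neg]

lemma card_image_inter {w : Equiv.Perm ℤ} (S T : Finset ℤ) :
    ((S.image fun a => w a) ∩ T).card = ∑ a ∈ S, if w a ∈ T then 1 else 0 := by
  rw [← Finset.card_filter, ← Finset.card_image_of_injective (S.filter fun a => w a ∈ T)
    w.injective, ← Finset.filter_mem_eq_inter, Finset.filter_image]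

/-- The sum of `mixedInversions` over a set stable under an involution. -/
lemma sum_mixedInversions {k1 k2 : ℤ} {T : Finset ℤ} {w : Equiv.Perm ℤ}
    (hT : ∀ x ∈ T, w x ∈ T) (hinv : ∀ x ∈ T, w (w x) = x)
    (hA : ∀ x, 0 < x → x < k1 → x ∈ T) (hB : ∀ x, k1 < x → x < k2 → x ∈ T) :
    (∑ x ∈ T, mixedInversions k1 k2 x (w x) : ℕ) = 2 * (k2 - k1 - 1).toNat +
      4 * ∑ x ∈ Finset.Icc 1 (k1 - 1), if w x < 0 ∨ k2 < w x then 1 else 0 := by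
  have hre (g : ℤ → ℕ) : ∑ x ∈ T, g (w x) = ∑ x ∈ T, g x :=
    Finset.sum_nbij' w w hT hT hinv hinv fun _ _ => rfl
  have hcardB : (∑ x ∈ T, if k1 < x ∧ x < k2 then 1 else 0) = (k2 - k1 - 1).toNat := by
    rw [← Finset.card_filter, ← Int.card_Ioo]
    congr 1
    ext x
    rw [Finset.mem_filter, Finset.mem_Ioo]
    exact ⟨fun h => h.2, fun h => ⟨hB x h.1 h.2, h⟩⟩
  have hcardA : (∑ x ∈ T, if (0 < x ∧ x < k1) ∧ (w x < 0 ∨ k2 < w x) then 1 else 0) =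
      ∑ x ∈ Finset.Icc 1 (k1 - 1), if w x < 0 ∨ k2 < w x then 1 else 0 := by
    rw [← Finset.card_filter, ← Finset.card_filter]
    congr 1
    ext x
    rw [Finset.mem_filter, Finset.mem_filter, Finset.mem_Icc]
    constructor
    · rintro ⟨_, h, h'⟩
      exact ⟨by omega, h'⟩
    · rintro ⟨h, h'⟩
      exact ⟨hA x (by omega) (by omega), by omega, h'⟩
  have hcardA' : (∑ x ∈ T, if (0 < w x ∧ w x < k1) ∧ (x < 0 ∨ k2 < x) then 1 else 0) =
      ∑ x ∈ T, if (0 < x ∧ x < k1) ∧ (w x < 0 ∨ k2 < w x) then 1 else 0 := by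
    rw [← hre fun x => if (0 < x ∧ x < k1) ∧ (w x < 0 ∨ k2 < w x) then 1 else 0]
    exact Finset.sum_congr rfl fun x hx => by rw [hinv x hx]
  simp only [mixedInversions, Finset.sum_add_distrib, ← Finset.mul_sum]
  rw [hre fun x => if k1 < x ∧ x < k2 then 1 else 0, hcardB, hcardA', hcardA]
  ring

/-- Let `w ∈ W` (type `Dₙ`) be an involution, let `w̃ ∈ W″` (type
`D_{n+2}`) be the element corresponding to `w` (fixing `k₁, k₂` and acting via the
increasing bijection `φ`), and let `w′ = w̃ ⬝ s_{η_{k₁} - η_{k₂}}`. Then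
`ℓ″(w′) = 2(k₂ - k₁ - 1) + 4|w̃(A) ∩ B⁻| + 4|w̃(A) ∩ A⁻| + 4|w̃(A) ∩ C^±| + ℓ(w) + 1`,
where `A = {1, …, k₁-1}`, `B = {k₁+1, …, k₂-1}`, `C = {k₂+1, …, n+2}`. -/
theorem statement3 (n : ℕ) (hn : 4 ≤ n) (k1 k2 : ℤ)
    (hk1 : 1 ≤ k1) (hk12 : k1 < k2) (hk2 : k2 ≤ (n : ℤ) + 2)
    (w : Equiv.Perm ℤ) (hw : IsD n w) (hinv : w * w = 1)
    (wt : Equiv.Perm ℤ) (hwt : IsD (n + 2) wt)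
    (hfix1 : wt k1 = k1) (hfix2 : wt k2 = k2)
    (hcomp : ∀ i : ℤ, 1 ≤ i → i ≤ (n : ℤ) →
      wt (phiMap k1 k2 i) = Int.sign (w i) * phiMap k1 k2 |w i|) :
    (weylLength (n + 2) (wt * (Equiv.swap k1 k2 * Equiv.swap (-k1) (-k2))) : ℤ)
      = 2 * (k2 - k1 - 1)
        + 4 * ((((Finset.Icc 1 (k1 - 1)).image fun a => wt a) ∩
            ((Finset.Icc (k1 + 1) (k2 - 1)).image fun b => -b)).card : ℤ)
        + 4 * ((((Finset.Icc 1 (k1 - 1)).image fun a => wt a) ∩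
            ((Finset.Icc 1 (k1 - 1)).image fun a => -a)).card : ℤ)
        + 4 * ((((Finset.Icc 1 (k1 - 1)).image fun a => wt a) ∩
            ((Finset.Icc (k2 + 1) ((n : ℤ) + 2)) ∪
              (Finset.Icc (k2 + 1) ((n : ℤ) + 2)).image fun c => -c)).card : ℤ)
        + (weylLength n w : ℤ) + 1 := by
  have hS := hw.isSigned
  have hSt := hwt.isSigned
  set s := Equiv.swap k1 k2 * Equiv.swap (-k1) (-k2) with hs
  have hsa (a : ℤ) := signedSwap_apply (u := k1) (v := k2) (by omega) (by omega) (by omega)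
    (by omega) a
  have hf1 : (wt * s) k1 = k2 := by
    rw [Equiv.Perm.mul_apply, hs, ← signedSwap, hsa, if_pos rfl, hfix2]
  have hf2 : (wt * s) k2 = k1 := by
    rw [Equiv.Perm.mul_apply, hs, ← signedSwap, hsa, if_neg (by omega), if_pos rfl, hfix1]
  have hf3 : (wt * s) (-k1) = -k2 := by
    rw [Equiv.Perm.mul_apply, hs, ← signedSwap, hsa, if_neg (by omega), if_neg (by omega),
      if_pos rfl, hSt.1, hfix2]
  have hf4 : (wt * s) (-k2) = -k1 := by
    rw [Equiv.Perm.mul_apply, hs, ← signedSwap, hsa, if_neg (by omega), if_neg (by omega),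
      if_neg (by omega), if_pos rfl, hSt.1, hfix1]
  have hf {x : ℤ} (hx : x ≠ k1 ∧ x ≠ k2 ∧ x ≠ -k1 ∧ x ≠ -k2) : (wt * s) x = wt x := by
    rw [Equiv.Perm.mul_apply, hs, ← signedSwap, hsa, if_neg hx.1, if_neg hx.2.1, if_neg hx.2.2.1,
      if_neg hx.2.2.2]
  have hD : IsD (n + 2) (wt * s) := by
    have hsS : IsSigned (n + 2) s := by
      refine ⟨fun i => ?_, fun i hi => ?_⟩
      · rw [hs, ← signedSwap, hsa, hsa]
        split_ifs <;> omega
      · rw [lt_abs] at hi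
        push_cast at hi
        rw [hs, ← signedSwap, hsa]
        split_ifs <;> omega
    obtain ⟨ho, hfx⟩ := hSt.mul hsS
    refine ⟨ho, hfx, ?_⟩
    convert hwt.2.2 using 2
    refine Finset.filter_congr fun i hi => ?_
    rw [Finset.mem_Icc] at hi
    by_cases h1 : i = k1
    · rw [h1, hf1, hfix1]
      omega
    by_cases h2 : i = k2
    · rw [h2, hf2, hfix2]
      omega
    rw [hf ⟨h1, h2, by omega, by omega⟩]
  set T := (letters n).image (signedPhi k1 k2) with hTdef
  have hmem {x : ℤ} := mem_image_signedPhi (x := x) hk1 hk12 hk2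
  rw [← hTdef] at hmem
  have hcompT {i : ℤ} (hi : i ∈ letters n) := apply_signedPhi hS hSt hcomp hi
  have hT (x : ℤ) (hx : x ∈ T) : wt x ∈ T := by
    obtain ⟨i, hi, rfl⟩ := Finset.mem_image.1 hx
    rw [hcompT hi]
    exact Finset.mem_image_of_mem _ (hS.map_mem hi)
  have hinvT (x : ℤ) (hx : x ∈ T) : wt (wt x) = x := by
    obtain ⟨i, hi, rfl⟩ := Finset.mem_image.1 hx
    rw [hcompT hi, hcompT (hS.map_mem hi), ← Equiv.Perm.mul_apply, hinv, Equiv.Perm.one_apply]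
  have hdisj : Disjoint T {k1, k2, -k1, -k2} := by
    rw [Finset.disjoint_left]
    intro x hx
    have := hmem.1 hx
    simp only [Finset.mem_insert, Finset.mem_singleton]
    omega
  have hTT : ∑ a ∈ T, ∑ b ∈ T, inversionIndicator (wt * s) a b = (inversions n w).card := by
    have hinj := (signedPhi_injective k1 k2).injOn (s := (letters n : Set ℤ))
    rw [card_inversions, hTdef, Finset.sum_image hinj]
    refine Finset.sum_congr rfl fun a ha => ?_
    rw [Finset.sum_image hinj]
    refine Finset.sum_congr rfl fun b hb => ?_
    have ha' := (mem_letters.1 ha).1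
    have hb' := (mem_letters.1 hb).1
    rw [inversionIndicator, inversionIndicator, hf (hmem.1 (Finset.mem_image_of_mem _ ha)).2,
      hf (hmem.1 (Finset.mem_image_of_mem _ hb)).2, hcompT ha, hcompT hb, ← signedPhi_neg hb']
    exact if_congr (and_congr (signedPhi_injective k1 k2).ne_iff
      (and_congr (precedes_signedPhi ha' hb')
        (precedes_signedPhi (hS.map_ne_zero hb') (hS.map_ne_zero ha')))) rfl rfl
  have hTK : ∑ a ∈ T, ∑ b ∈ {k1, k2, -k1, -k2},
      (inversionIndicator (wt * s) a b + inversionIndicator (wt * s) b a) =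
      2 * ∑ x ∈ T, mixedInversions k1 k2 x (wt x) := by
    have hpoint : ∀ a ∈ T, ∑ b ∈ {k1, k2, -k1, -k2},
        (inversionIndicator (wt * s) a b + inversionIndicator (wt * s) b a) =
        mixedInversions k1 k2 a (wt a) + mixedInversions k1 k2 (-a) (wt (-a)) := by
      intro a ha
      have h1 := hmem.1 ha
      have h2 := hmem.1 (hT a ha)
      have h3 := hf h1.2
      rw [sum_inversionIndicator hk1 hk12 ⟨h1.1.1, h1.2⟩ (by rw [h3]; exact ⟨h2.1.1, h2.2⟩)
        hf1 hf2 hf3 hf4, h3, hSt.1]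
    have hneg (a : ℤ) (ha : a ∈ T) : -a ∈ T := by
      rw [hmem] at ha ⊢
      omega
    rw [Finset.sum_congr rfl hpoint, Finset.sum_add_distrib, two_mul]
    congr 1
    exact Finset.sum_nbij' Neg.neg Neg.neg hneg hneg (fun _ _ => neg_neg _) (fun _ _ => neg_neg _)
      fun _ _ => rfl
  have hlen := hw.two_mul_weylLength (by omega)
  have hlen' := hD.two_mul_weylLength (by omega)
  rw [card_inversions, letters_add_two hk1 hk12 hk2, ← hTdef, sum_union_sum_union hdisj, hTT, hTK,
    sum_sum_inversionIndicator hk1 hk12 hf1 hf2 hf3 hf4, sum_mixedInversions hT hinvT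
      (fun x h h' => hmem.2 (by omega)) (fun x h h' => hmem.2 (by omega))] at hlen'
  have hsets : (∑ x ∈ Finset.Icc 1 (k1 - 1), if wt x < 0 ∨ k2 < wt x then 1 else 0) =
      (((Finset.Icc 1 (k1 - 1)).image fun a => wt a) ∩
        ((Finset.Icc (k1 + 1) (k2 - 1)).image fun b => -b)).card +
      (((Finset.Icc 1 (k1 - 1)).image fun a => wt a) ∩
        ((Finset.Icc 1 (k1 - 1)).image fun a => -a)).card +
      (((Finset.Icc 1 (k1 - 1)).image fun a => wt a) ∩
        ((Finset.Icc (k2 + 1) ((n : ℤ) + 2)) ∪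
          (Finset.Icc (k2 + 1) ((n : ℤ) + 2)).image fun c => -c)).card := by
    rw [card_image_inter, card_image_inter, card_image_inter, ← Finset.sum_add_distrib,
      ← Finset.sum_add_distrib]
    refine Finset.sum_congr rfl fun x hx => ?_
    rw [Finset.mem_Icc] at hx
    have hy := hmem.1 (hT x (hmem.2 (by omega)))
    have hneg (y a b : ℤ) : y ∈ (Finset.Icc a b).image (fun c => -c) ↔ a ≤ -y ∧ -y ≤ b := by
      rw [Finset.mem_image]
      refine ⟨?_, fun h => ⟨-y, Finset.mem_Icc.2 h, neg_neg y⟩⟩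
      rintro ⟨c, hc, rfl⟩
      rwa [neg_neg, ← Finset.mem_Icc]
    simp only [Finset.mem_union, hneg, Finset.mem_Icc]
    clear hx
    split_ifs <;> omega
  rw [hsets] at hlen'
  omega
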